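/- In the braid group B_{2n} (n ≥ 2), the elements p_i = σ_{2i} σ_{2i−1} σ_{2i+1}^{-1} σ_{2i}^{-1} satisfy the braid relations: p_i p_j = p_j p_i for |i−j| > 1 and p_i p_j p_i = p_j p_i p_j for |i−j| = 1, for all valid indices 1 ≤ i, j < n. -/

import Mathlib

/-- The braid relations on `m` generators `σ_1, …, σ_m` (indexed by `Fin m`):
`σᵢσⱼ = σⱼσᵢ` for `|i−j| > 1` and `σᵢσⱼσᵢ = σⱼσᵢσⱼ` for `|i−j| = 1`. -/
def braidRels (m : ℕ) : Set (FreeGroup (Fin m)) :=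
  { w | (∃ i j : Fin m, (i : ℕ) + 1 < (j : ℕ) ∧
          w = FreeGroup.of i * FreeGroup.of j * (FreeGroup.of i)⁻¹ * (FreeGroup.of j)⁻¹) ∨
        (∃ i j : Fin m, (i : ℕ) + 1 = (j : ℕ) ∧
          w = FreeGroup.of i * FreeGroup.of j * FreeGroup.of i *
              (FreeGroup.of j * FreeGroup.of i * FreeGroup.of j)⁻¹) }

/-- The braid group on `m + 1` strands, with generators `σ_1, …, σ_m`. -/
def BraidGroup (m : ℕ) : Type := PresentedGroup (braidRels m)

instance (m : ℕ) : Group (BraidGroup m) :=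
  inferInstanceAs (Group (PresentedGroup (braidRels m)))

/-- The standard Artin generator `σ_k` (for `1 ≤ k ≤ m`). -/
def bσ {m : ℕ} (k : ℕ) : BraidGroup m :=
  if h : k - 1 < m then PresentedGroup.of (⟨k - 1, h⟩ : Fin m) else 1

/-- `sᵢ = σ_{2i} σ_{2i−1} σ_{2i+1} σ_{2i}`. -/
def bs {m : ℕ} (i : ℕ) : BraidGroup m := bσ (2*i) * bσ (2*i - 1) * bσ (2*i + 1) * bσ (2*i)

/-- `tᵢ = σ_{2i−1}`. -/
def bt {m : ℕ} (i : ℕ) : BraidGroup m := bσ (2*i - 1)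

/-- `pᵢ = σ_{2i} σ_{2i−1} σ_{2i+1}⁻¹ σ_{2i}⁻¹`. -/
def bp {m : ℕ} (i : ℕ) : BraidGroup m := bσ (2*i) * bσ (2*i - 1) * (bσ (2*i + 1))⁻¹ * (bσ (2*i))⁻¹

/-- `r₁ = σ₂ σ₁ σ₃⁻¹ σ₂⁻¹`. -/
def br1 {m : ℕ} : BraidGroup m := bσ 2 * bσ 1 * (bσ 3)⁻¹ * (bσ 2)⁻¹

/-- `r₂ = σ₄ σ₃ σ₂ σ₁ σ₅⁻¹ σ₄⁻¹ σ₃⁻¹ σ₂⁻¹`. -/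
def br2 {m : ℕ} : BraidGroup m :=
  bσ 4 * bσ 3 * bσ 2 * bσ 1 * (bσ 5)⁻¹ * (bσ 4)⁻¹ * (bσ 3)⁻¹ * (bσ 2)⁻¹

theorem bσ_eq {m : ℕ} (k : ℕ) (h : k - 1 < m) :
    (bσ k : BraidGroup m) =
      (show BraidGroup m from PresentedGroup.mk (braidRels m) (FreeGroup.of ⟨k - 1, h⟩)) :=
  dif_pos h

theorem bσ_comm {m : ℕ} (i j : ℕ) (hi : 1 ≤ i) (hij : i + 1 < j) (hj : j ≤ m) :
    Commute (bσ i : BraidGroup m) (bσ j) := by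
  have h1 : i - 1 < m := by omega
  have h2 : j - 1 < m := by omega
  have h : (PresentedGroup.mk (braidRels m)) (FreeGroup.of ⟨i-1, h1⟩ * FreeGroup.of ⟨j-1, h2⟩ *
      (FreeGroup.of ⟨i-1, h1⟩)⁻¹ * (FreeGroup.of ⟨j-1, h2⟩)⁻¹) = 1 := by
    apply PresentedGroup.one_of_mem
    left
    exact ⟨⟨i-1, h1⟩, ⟨j-1, h2⟩, by simp only; omega, rfl⟩
  simp only [map_mul, map_inv] at h
  rw [bσ_eq i h1, bσ_eq j h2]
  exact mul_inv_eq_iff_eq_mul.mp (mul_inv_eq_one.mp h)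

theorem bσ_braid {m : ℕ} (i j : ℕ) (hi : 1 ≤ i) (hij : i + 1 = j) (hj : j ≤ m) :
    (bσ i : BraidGroup m) * bσ j * bσ i = bσ j * bσ i * bσ j := by
  have h1 : i - 1 < m := by omega
  have h2 : j - 1 < m := by omega
  have h : (PresentedGroup.mk (braidRels m)) (FreeGroup.of ⟨i-1, h1⟩ * FreeGroup.of ⟨j-1, h2⟩ *
      FreeGroup.of ⟨i-1, h1⟩ *
      (FreeGroup.of ⟨j-1, h2⟩ * FreeGroup.of ⟨i-1, h1⟩ * FreeGroup.of ⟨j-1, h2⟩)⁻¹) = 1 := by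
    apply PresentedGroup.one_of_mem
    right
    exact ⟨⟨i-1, h1⟩, ⟨j-1, h2⟩, by simp only; omega, rfl⟩
  simp only [map_mul, map_inv] at h
  rw [bσ_eq i h1, bσ_eq j h2]
  exact mul_inv_eq_one.mp h

section aux
variable {G : Type*} [Group G]

theorem aux_conj {a b : G} (h : a * b * a = b * a * b) : b * a * b⁻¹ = a⁻¹ * b * a := by
  rw [mul_inv_eq_iff_eq_mul, mul_assoc, mul_assoc, eq_inv_mul_iff_mul_eq, ← mul_assoc, h]
  simp only [mul_assoc]

theorem aux_conj2 {a b : G} (h : a * b * a = b * a * b) : b⁻¹ * a * b = a * b * a⁻¹ :=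
  (aux_conj h.symm).symm

theorem aux_braid_conj {a b g : G} (h : a * b * a = b * a * b) :
    (g * a * g⁻¹) * (g * b * g⁻¹) * (g * a * g⁻¹) =
      (g * b * g⁻¹) * (g * a * g⁻¹) * (g * b * g⁻¹) := by
  have := congrArg (MulAut.conj g) h
  simpa only [map_mul, MulAut.conj_apply] using this

theorem aux_fix {g y : G} (h : Commute g y) : g * y * g⁻¹ = y := by
  rw [h.eq, mul_inv_cancel_right]

theorem aux_split {x y z w : G} (hxy : Commute x y) (hxw : Commute x w) (hzy : Commute z y)
    (hzw : Commute z w) (h1 : x * z * x = z * x * z) (h2 : y * w * y = w * y * w) :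
    (x * y⁻¹) * (z * w⁻¹) * (x * y⁻¹) = (z * w⁻¹) * (x * y⁻¹) * (z * w⁻¹) := by
  have key : ∀ x y z w : G, Commute x y → Commute x w → Commute z y →
      (x * y⁻¹) * (z * w⁻¹) * (x * y⁻¹) = (x * z * x) * (y * w * y)⁻¹ := by
    intro x y z w hxy hxw hzy
    have e1 : y⁻¹ * z = z * y⁻¹ := (hzy.inv_right).eq.symm
    have e2 : y⁻¹ * w⁻¹ * x = x * (y⁻¹ * w⁻¹) :=
      ((hxy.inv_right).mul_right hxw.inv_right).eq.symm
    calc (x * y⁻¹) * (z * w⁻¹) * (x * y⁻¹) = x * (y⁻¹ * z) * w⁻¹ * x * y⁻¹ := by group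
      _ = x * z * (y⁻¹ * w⁻¹ * x) * y⁻¹ := by rw [e1]; group
      _ = _ := by rw [e2]; group
  rw [key x y z w hxy hxw hzy, key z w x y hzw hzy hxw, h1, h2]

theorem aux_main {a b c d e : G} (ab : a * b * a = b * a * b) (bc : b * c * b = c * b * c)
    (cd : c * d * c = d * c * d) (de : d * e * d = e * d * e)
    (ac : Commute a c) (ad : Commute a d) (ae : Commute a e) (bd : Commute b d)
    (be : Commute b e) (ce : Commute c e) :
    (b * a * c⁻¹ * b⁻¹) * (d * c * e⁻¹ * d⁻¹) * (b * a * c⁻¹ * b⁻¹) =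
      (d * c * e⁻¹ * d⁻¹) * (b * a * c⁻¹ * b⁻¹) * (d * c * e⁻¹ * d⁻¹) := by
  have p1 : b * a * c⁻¹ * b⁻¹ = (b * a * b⁻¹) * (b * c * b⁻¹)⁻¹ := by group
  have p2 : d * c * e⁻¹ * d⁻¹ = (d * c * d⁻¹) * (d * e * d⁻¹)⁻¹ := by group
  have dx : Commute d (b * a * b⁻¹) := (bd.symm.mul_right ad.symm).mul_right bd.symm.inv_right
  have ex : Commute e (b * a * b⁻¹) := (be.symm.mul_right ae.symm).mul_right be.symm.inv_right
  have ey : Commute e (b * c * b⁻¹) := (be.symm.mul_right ce.symm).mul_right be.symm.inv_right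
  rw [p1, p2]
  apply aux_split
  · exact Commute.conj_iff b |>.mpr ac
  · exact ((dx.mul_left ex).mul_left dx.inv_left).symm
  · have h := (Commute.conj_iff c⁻¹).mpr bd.symm
    rwa [inv_inv, ← aux_conj cd, aux_conj2 bc] at h
  · exact Commute.conj_iff d |>.mpr ce
  · have h : a⁻¹ * c * a⁻¹⁻¹ = c := aux_fix ac.inv_left
    have h3 := aux_braid_conj (g := a⁻¹) bc
    rw [h, inv_inv, ← aux_conj ab] at h3
    have h4 := aux_braid_conj (g := d) h3
    rwa [aux_fix dx] at h4
  · have h : b * d * b⁻¹ = d := aux_fix bd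
    have h3 := aux_braid_conj (g := b) cd
    rw [h] at h3
    have h4 := aux_braid_conj (g := e⁻¹) h3
    rwa [aux_fix ey.inv_left, inv_inv, aux_conj2 de] at h4
end aux

theorem stmt11 (n : ℕ) (hn : 2 ≤ n) :
    ∀ i j : ℕ, 1 ≤ i → i < n → 1 ≤ j → j < n →
      ((i + 1 < j ∨ j + 1 < i) →
        (bp i : BraidGroup (2 * n - 1)) * bp j = bp j * bp i) ∧
      ((j = i + 1 ∨ i = j + 1) →
        (bp i : BraidGroup (2 * n - 1)) * bp j * bp i = bp j * bp i * bp j) := by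
  have hc : ∀ i j : ℕ, 1 ≤ i → i + 1 < j → j < n →
      Commute (bp i : BraidGroup (2 * n - 1)) (bp j) := by
    intro i j hi hij hj
    have key : ∀ k, 1 ≤ k → k + 1 < 2 * j - 1 →
        Commute (bσ k : BraidGroup (2 * n - 1)) (bp j) := by
      intro k hk hkj
      unfold bp
      exact (((bσ_comm _ _ hk (by omega) (by omega)).mul_right
        (bσ_comm _ _ hk (by omega) (by omega))).mul_right
        (bσ_comm _ _ hk (by omega) (by omega)).inv_right).mul_right
        (bσ_comm _ _ hk (by omega) (by omega)).inv_right
    have h : Commute (bσ (2*i) * bσ (2*i - 1) * (bσ (2*i + 1))⁻¹ * (bσ (2*i))⁻¹ :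
        BraidGroup (2 * n - 1)) (bp j) :=
      (((key _ (by omega) (by omega)).mul_left (key _ (by omega) (by omega))).mul_left
        (key _ (by omega) (by omega)).inv_left).mul_left (key _ (by omega) (by omega)).inv_left
    exact h
  have hb : ∀ i : ℕ, 1 ≤ i → i + 1 < n →
      (bp i : BraidGroup (2 * n - 1)) * bp (i+1) * bp i = bp (i+1) * bp i * bp (i+1) := by
    intro i hi hj
    have e1 : 2 * (i + 1) - 1 = 2 * i + 1 := by omega
    unfold bp
    rw [e1]
    apply aux_main
    all_goals first
      | exact bσ_comm _ _ (by omega) (by omega) (by omega)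
      | exact bσ_braid _ _ (by omega) (by omega) (by omega)
  intro i j hi hin hj hjn
  refine ⟨?_, ?_⟩
  · rintro (h | h)
    · exact (hc i j hi h hjn).eq
    · exact (hc j i hj h hin).symm.eq
  · rintro (rfl | rfl)
    · exact hb i hi hjn
    · exact (hb j hj hin).symm
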